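/- Let G be a finite simple graph, d ≥ 1 an integer, and M ⊆ V(G) a set such that G − M is a caterpillar forest. Let P̂ be a packing of pairwise vertex-disjoint connected merged subgraphs of G − M, and for each chunk X let P̂^X = {H ∈ P̂ : conf_H(X) > 0}. Then there is a minimum d-coc set S of G that intersects every chunk X with |P̂^X| ≥ |M| + 2(d−1). -/

import Mathlib

namespace CocPaper

open SimpleGraph

variable {V : Type} {W : Type}

/-- `S` is a `d`-coc set of the subgraph of `G` induced on the vertex set `A`:
after deleting `S`, every connected component has at most `d` vertices. -/
def IsCocSetOn (G : SimpleGraph V) (A : Set V) (d : ℕ) (S : Set V) : Prop :=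
  ∀ c : (G.induce (A \ S)).ConnectedComponent, c.supp.ncard ≤ d

/-- The minimum size of a `d`-coc set of the subgraph of `G` induced on `A`. -/
noncomputable def cocOptOn (G : SimpleGraph V) (A : Set V) (d : ℕ) : ℕ :=
  sInf {m : ℕ | ∃ S : Set V, S ⊆ A ∧ IsCocSetOn G A d S ∧ S.ncard = m}

/-- `S` is a minimum `d`-coc set of the subgraph of `G` induced on `A`. -/
def IsMinCocSetOn (G : SimpleGraph V) (A : Set V) (d : ℕ) (S : Set V) : Prop :=
  S ⊆ A ∧ IsCocSetOn G A d S ∧ S.ncard = cocOptOn G A d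

/-- `X` is a `d`-blocking set of `G[A]`: no minimum `d`-coc set contains `X`. -/
def IsBlockingSetOn (G : SimpleGraph V) (A : Set V) (d : ℕ) (X : Set V) : Prop :=
  ∀ S : Set V, IsMinCocSetOn G A d S → ¬ X ⊆ S

/-- A minimal `d`-blocking set: a `d`-blocking set no proper subset of which is one. -/
def IsMinimalBlockingSetOn (G : SimpleGraph V) (A : Set V) (d : ℕ) (X : Set V) : Prop :=
  IsBlockingSetOn G A d X ∧ ∀ Y : Set V, Y ⊂ X → ¬ IsBlockingSetOn G A d Y

/-- `G` is (isomorphic to) a path graph, possibly empty. -/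
def IsPathGraph (G : SimpleGraph V) : Prop :=
  ∃ n : ℕ, Nonempty (G ≃g SimpleGraph.pathGraph n)

/-- A caterpillar: a tree such that deleting all vertices of degree one yields a
(possibly empty) path. -/
def IsCaterpillar (G : SimpleGraph V) : Prop :=
  G.IsTree ∧ IsPathGraph (G.induce {v : V | (G.neighborSet v).ncard ≠ 1})

/-- A caterpillar forest: every connected component is a caterpillar. -/
def IsCaterpillarForest (G : SimpleGraph V) : Prop :=
  ∀ c : G.ConnectedComponent, IsCaterpillar (G.induce c.supp)

/-- `G` is (isomorphic to) a cycle graph. -/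
def IsCycleGraph (G : SimpleGraph V) : Prop :=
  ∃ n : ℕ, 3 ≤ n ∧ Nonempty (G ≃g SimpleGraph.cycleGraph n)

/-- A connected subgraph of `G` which is a caterpillar, equipped with a fixed
nonempty spine listed in left-to-right order: the spine is a path in `G` inside
`verts`, and every vertex of `verts` off the spine has degree one in the subgraph. -/
structure SubCaterpillar (G : SimpleGraph V) where
  verts : Set V
  n : ℕ
  npos : 0 < n
  spine : Fin n → V
  spineMem : ∀ i, spine i ∈ verts
  spineInj : Function.Injective spine
  spineAdj : ∀ (i : ℕ) (h : i + 1 < n),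
    G.Adj (spine ⟨i, Nat.lt_of_succ_lt h⟩) (spine ⟨i + 1, h⟩)
  isTree : (G.induce verts).IsTree
  pendant : ∀ v ∈ verts, v ∉ Set.range spine → {w : V | w ∈ verts ∧ G.Adj v w}.ncard = 1

/-- The spine position of a vertex of the caterpillar: its spine index if it is a
spine vertex, and the spine index of its parent if it is a pendant. -/
noncomputable def SubCaterpillar.pos {G : SimpleGraph V} (C : SubCaterpillar G) (v : V) : ℕ :=
  sInf {i : ℕ | ∃ h : i < C.n,
    C.spine ⟨i, h⟩ = v ∨ (v ∉ Set.range C.spine ∧ G.Adj v (C.spine ⟨i, h⟩))}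

/-- `P` is a solution-tight packing of the spined caterpillar `C` with respect to `d`.
Packed (induced, connected) subgraphs are represented by their vertex sets. -/
def IsSTP (G : SimpleGraph V) (d : ℕ) (C : SubCaterpillar G) (P : Finset (Set V)) : Prop :=
  (∀ A ∈ P, A ⊆ C.verts ∧ d + 1 ≤ A.ncard ∧ (G.induce A).Connected) ∧
  ((↑P : Set (Set V)).Pairwise fun A B => Disjoint A B) ∧
  P.card = cocOptOn G C.verts d ∧
  (∀ A ∈ P, ∀ v ∈ C.verts, v ∉ Set.range C.spine → ∀ w ∈ A, G.Adj v w → v ∈ A) ∧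
  (∃ i : ℕ, i ≤ C.n ∧ ∀ j : Fin C.n, ((j : ℕ) < i ↔ ∃ A ∈ P, C.spine j ∈ A)) ∧
  (∀ A ∈ P, ∀ j : Fin C.n, C.spine j ∈ A →
    (∀ j' : Fin C.n, C.spine j' ∈ A → (j' : ℕ) ≤ (j : ℕ)) →
    IsCocSetOn G A d {C.spine j})

/-- A caterpillar forest on the vertex set `F` inside the ambient graph `G`,
with a fixed spine and spine order for each connected component. -/
structure SpinedCatForest (G : SimpleGraph V) (F : Set V) where
  numComps : ℕ
  comp : Fin numComps → SubCaterpillar G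
  sub : ∀ c, (comp c).verts ⊆ F
  cover : ∀ v ∈ F, ∃ c, v ∈ (comp c).verts
  disj : ∀ c c', c ≠ c' → Disjoint (comp c).verts (comp c').verts
  noCross : ∀ c c', c ≠ c' → ∀ v ∈ (comp c).verts, ∀ w ∈ (comp c').verts, ¬ G.Adj v w

/-- `P` is a solution-tight packing of the caterpillar forest `𝔉`: the union over the
connected components of solution-tight packings of the components. -/
def IsForestSTP (G : SimpleGraph V) (d : ℕ) {F : Set V} (𝔉 : SpinedCatForest G F)
    (P : Finset (Set V)) : Prop :=
  ∃ Q : Fin 𝔉.numComps → Finset (Set V),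
    (∀ c, IsSTP G d (𝔉.comp c) (Q c)) ∧
    (↑P : Set (Set V)) = ⋃ c, (↑(Q c) : Set (Set V))

/-- Attach `x` new pendant vertices to the vertex `v` of `H`. -/
def attachPendants (H : SimpleGraph W) (v : W) (x : ℕ) : SimpleGraph (W ⊕ Fin x) :=
  SimpleGraph.fromRel fun a b =>
    (∃ u u', a = Sum.inl u ∧ b = Sum.inl u' ∧ H.Adj u u') ∨
    (∃ i : Fin x, a = Sum.inl v ∧ b = Sum.inr i)

/-- The number of vertices of the connected component of `v` in the graph obtained
from `G[A]` by deleting `S` (this is `0` when `v ∈ S` or `v ∉ A`). -/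
noncomputable def compSizeOn (G : SimpleGraph V) (A S : Set V) (v : V) : ℕ :=
  {w : V | ∃ (hv : v ∈ A \ S) (hw : w ∈ A \ S),
    (G.induce (A \ S)).Reachable ⟨v, hv⟩ ⟨w, hw⟩}.ncard

/-- The essence of a spined caterpillar `C` relative to `d`. -/
noncomputable def SubCaterpillar.essence {G : SimpleGraph V} (C : SubCaterpillar G)
    (d : ℕ) : ℕ → ℕ := fun x =>
  let Cx : SimpleGraph (↥C.verts ⊕ Fin x) :=
    attachPendants (G.induce C.verts) ⟨C.spine ⟨0, C.npos⟩, C.spineMem ⟨0, C.npos⟩⟩ x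
  let vlast : ↥C.verts ⊕ Fin x :=
    Sum.inl ⟨C.spine ⟨C.n - 1, Nat.sub_lt C.npos Nat.one_pos⟩,
      C.spineMem ⟨C.n - 1, Nat.sub_lt C.npos Nat.one_pos⟩⟩
  if x ≤ d ∧ cocOptOn Cx Set.univ d = cocOptOn G C.verts d then
    sInf {b : ℕ | ∃ Y : Set (↥C.verts ⊕ Fin x),
      IsMinCocSetOn Cx Set.univ d Y ∧ b = compSizeOn Cx Set.univ Y vlast}
  else d + 1

/-- The set of vertices of `A` adjacent (in `G`) to some vertex of `X`. -/
def nbrIn (G : SimpleGraph V) (A X : Set V) : Set V :=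
  {v : V | v ∈ A ∧ ∃ m ∈ X, G.Adj v m}

/-- The chunk `X` imposes a (strictly positive) conflict on the subgraph of `G`
induced on the vertex set `A`. -/
def HasConflict (G : SimpleGraph V) (d : ℕ) (A X : Set V) : Prop :=
  cocOptOn G A d < (nbrIn G A X).ncard + cocOptOn G (A \ nbrIn G A X) d

/-- A chunk: a subset of the modulator `M` of size one or two. -/
def IsChunk (M X : Set V) : Prop := X ⊆ M ∧ 1 ≤ X.ncard ∧ X.ncard ≤ 2

/-- The `i`-th graph (0-based) of the `α`-merged packing of the ordered packing `H`. -/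
def mergedPiece {t : ℕ} (H : Fin t → Set V) (α i : ℕ) : Set V :=
  ⋃ (j : Fin t) (_ : i * α ≤ (j : ℕ) ∧ (j : ℕ) < i * α + α), H j

/-- `H` enumerates a solution-tight packing of `C` in left-to-right spine order. -/
def IsOrderedSTP (G : SimpleGraph V) (d : ℕ) (C : SubCaterpillar G) {t : ℕ}
    (H : Fin t → Set V) : Prop :=
  Function.Injective H ∧
  (∃ P : Finset (Set V), IsSTP G d C P ∧ (↑P : Set (Set V)) = Set.range H) ∧
  ∀ k k' : Fin t, k < k' → ∀ v ∈ H k, ∀ w ∈ H k', C.pos v < C.pos w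

/-- Composition of a list of functions: `compList [g₁, …, gₗ] = g₁ ∘ g₂ ∘ ⋯ ∘ gₗ`. -/
def compList (L : List (ℕ → ℕ)) : ℕ → ℕ := L.foldr (· ∘ ·) id

/-- `inc^d_i`: maps `i` to `i+1` and fixes all other inputs. -/
def incAt (i : ℕ) : ℕ → ℕ := fun x => if x = i then i + 1 else x

/-- `dec^d_i`: maps `i` to `i-1` and fixes all other inputs. -/
def decAt (i : ℕ) : ℕ → ℕ := fun x => if x = i then i - 1 else x

/-- `inc^d`: maps every `x` with `1 ≤ x ≤ d` to `x+1` and fixes all other inputs. -/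
def incUpTo (d : ℕ) : ℕ → ℕ := fun x => if 1 ≤ x ∧ x ≤ d then x + 1 else x

/-- `inc^d_{i,j}`: maps every `x` with `i ≤ x ≤ j` to `j` and fixes all other inputs. -/
def incIJ (i j : ℕ) : ℕ → ℕ := fun x => if i ≤ x ∧ x ≤ j then j else x

/-- `dec^d_{i,j}`: maps every `x` with `i ≤ x ≤ j` to `i` and fixes all other inputs. -/
def decIJ (i j : ℕ) : ℕ → ℕ := fun x => if i ≤ x ∧ x ≤ j then i else x

/-- The basic functions relative to `d`. -/
def IsBasicFun (d : ℕ) (f : ℕ → ℕ) : Prop :=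
  f = id ∨ (∃ i, 1 ≤ i ∧ i ≤ d ∧ f = decAt i) ∨ f = incUpTo d

/-- The advanced functions relative to `d`. -/
def IsAdvancedFun (d : ℕ) (f : ℕ → ℕ) : Prop :=
  (∃ i, 1 ≤ i ∧ i ≤ d ∧ f = incAt i) ∨
  (∃ i j, 1 ≤ i ∧ i < j ∧ j ≤ d + 1 ∧ f = incIJ i j) ∨
  (∃ i j, i < j ∧ j ≤ d ∧ f = decIJ i j)

/-- The number of fixed points of `f` on the domain `{0, …, d+1}`. -/
def fixCount (d : ℕ) (f : ℕ → ℕ) : ℕ :=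
  ((Finset.range (d + 2)).filter fun x => f x = x).card

/-- The disjoint union of `G₁` and `G₂` together with the edge `a b`. -/
def joinGraph {V₁ V₂ : Type} (G₁ : SimpleGraph V₁) (G₂ : SimpleGraph V₂)
    (a : V₁) (b : V₂) : SimpleGraph (V₁ ⊕ V₂) :=
  SimpleGraph.fromRel fun x y =>
    (∃ u w, x = Sum.inl u ∧ y = Sum.inl w ∧ G₁.Adj u w) ∨
    (∃ u w, x = Sum.inr u ∧ y = Sum.inr w ∧ G₂.Adj u w) ∨
    (x = Sum.inl a ∧ y = Sum.inr b)

lemma connected_induce_image_val (G : SimpleGraph V) {s : Set V} {t : Set s}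
    (h : ((G.induce s).induce t).Connected) : (G.induce (Subtype.val '' t)).Connected := by
  let f : (G.induce s).induce t →g G.induce (Subtype.val '' t) :=
    { toFun := fun x => ⟨x.1.1, x.1, x.2, rfl⟩
      map_rel' := fun h => h }
  refine h.map (f := f) ?_
  rintro ⟨_, x, hx, rfl⟩
  exact ⟨⟨x, hx⟩, rfl⟩

/-- A `d`-coc set is one whose complement contains no connected set of more than `d` vertices. -/
lemma isCocSetOn_iff [Finite V] {G : SimpleGraph V} {A S : Set V} {d : ℕ} :
    IsCocSetOn G A d S ↔ ∀ B ⊆ A \ S, (G.induce B).Connected → B.ncard ≤ d := by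
  constructor
  · intro h B hB hc
    obtain ⟨b⟩ := hc.nonempty
    refine le_trans ?_ (h ((G.induce (A \ S)).connectedComponentMk ⟨b, hB b.2⟩))
    rw [← Set.ncard_image_of_injective _ Subtype.val_injective]
    refine Set.ncard_le_ncard (fun v hv => ⟨⟨v, hB hv⟩, ?_, rfl⟩) (Set.toFinite _)
    rw [ConnectedComponent.mem_supp_iff, ConnectedComponent.eq]
    exact (hc.preconnected ⟨v, hv⟩ b).map (G.induceHomOfLE hB).toHom
  · intro h c
    rw [← Set.ncard_image_of_injective _ Subtype.val_injective]
    exact h _ (by rintro _ ⟨x, -, rfl⟩; exact x.2)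
      (connected_induce_image_val G c.connected_toSimpleGraph)

lemma IsCocSetOn.mono [Finite V] {G : SimpleGraph V} {A A' S S' : Set V} {d : ℕ}
    (h : IsCocSetOn G A d S) (hsub : A' \ S' ⊆ A \ S) : IsCocSetOn G A' d S' :=
  isCocSetOn_iff.2 fun B hB hc => isCocSetOn_iff.1 h B (hB.trans hsub) hc

lemma cocOptOn_le {G : SimpleGraph V} {A S : Set V} {d : ℕ} (hS : S ⊆ A)
    (h : IsCocSetOn G A d S) : cocOptOn G A d ≤ S.ncard :=
  Nat.sInf_le ⟨S, hS, h, rfl⟩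

lemma exists_isMinCocSetOn (G : SimpleGraph V) (A : Set V) (d : ℕ) :
    ∃ S, IsMinCocSetOn G A d S := by
  have hne : {m : ℕ | ∃ S : Set V, S ⊆ A ∧ IsCocSetOn G A d S ∧ S.ncard = m}.Nonempty := by
    refine ⟨_, A, subset_rfl, fun c => ?_, rfl⟩
    obtain ⟨⟨v, hv⟩, -⟩ := c.nonempty_supp
    exact absurd hv.1 hv.2
  exact Nat.sInf_mem hne

lemma injOn_of_forall_mem {R : Set (Set V)} (hdisj : R.Pairwise fun A B => Disjoint A B)
    {f : Set V → V} (hf : ∀ B ∈ R, f B ∈ B) : R.InjOn f := by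
  intro A hA B hB hAB
  by_contra hne
  exact Set.disjoint_left.1 (hdisj hA hB hne) (hf A hA) (hAB ▸ hf B hB)

/-- A `d`-coc set has as many elements in a union of disjoint connected sets of more than `d`
vertices as there are such sets. -/
lemma IsCocSetOn.exists_injOn [Finite V] [Nonempty V] {G : SimpleGraph V} {A S : Set V} {d : ℕ}
    (h : IsCocSetOn G A d S) {P : Set (Set V)}
    (hP : ∀ B ∈ P, B ⊆ A ∧ d + 1 ≤ B.ncard ∧ (G.induce B).Connected)
    (hdisj : P.Pairwise fun A B => Disjoint A B) :
    ∃ f : Set V → V, (∀ B ∈ P, f B ∈ S ∩ B) ∧ P.InjOn f := by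
  have hex : ∀ B ∈ P, ∃ v, v ∈ S ∩ B := by
    intro B hB
    obtain ⟨hBA, hcard, hc⟩ := hP B hB
    by_contra! hne
    have := isCocSetOn_iff.1 h B (fun v hv => ⟨hBA hv, fun hvS => hne v ⟨hvS, hv⟩⟩) hc
    omega
  choose! f hf using hex
  exact ⟨f, hf, injOn_of_forall_mem hdisj fun B hB => (hf B hB).2⟩

lemma IsForestSTP.mem_props {G : SimpleGraph V} {d : ℕ} {F : Set V} {𝔉 : SpinedCatForest G F}
    {P : Finset (Set V)} (hP : IsForestSTP G d 𝔉 P) :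
    (∀ B ∈ P, B ⊆ F ∧ d + 1 ≤ B.ncard ∧ (G.induce B).Connected) ∧
      (↑P : Set (Set V)).Pairwise fun A B => Disjoint A B := by
  obtain ⟨Q, hQ, hPQ⟩ := hP
  have hmem : ∀ B ∈ P, ∃ c, B ∈ Q c := fun B hB => by
    simpa using hPQ.subset (Finset.mem_coe.2 hB)
  refine ⟨fun B hB => ?_, fun B hB C hC hne => ?_⟩
  · obtain ⟨c, hc⟩ := hmem B hB
    obtain ⟨h1, h2⟩ := (hQ c).1 B hc
    exact ⟨h1.trans (𝔉.sub c), h2⟩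
  · obtain ⟨b, hb⟩ := hmem B hB
    obtain ⟨c, hc⟩ := hmem C hC
    by_cases hbc : b = c
    · subst hbc
      exact (hQ b).2.1 hb hc hne
    · exact (𝔉.disj b c hbc).mono ((hQ b).1 B hb).1 ((hQ c).1 C hc).1

lemma IsForestSTP.sum_cocOptOn_le {G : SimpleGraph V} {d : ℕ} {F : Set V}
    {𝔉 : SpinedCatForest G F} {P : Finset (Set V)} (hP : IsForestSTP G d 𝔉 P) :
    ∑ c, cocOptOn G (𝔉.comp c).verts d ≤ P.card := by
  classical
  obtain ⟨Q, hQ, hPQ⟩ := hP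
  have hPQ' : P = Finset.univ.biUnion Q := by
    apply Finset.coe_injective
    simpa using hPQ
  rw [hPQ', Finset.card_biUnion]
  · exact Finset.sum_le_sum fun c _ => (hQ c).2.2.1.ge
  · intro b _ c _ hbc
    refine Finset.disjoint_left.2 fun B hb hc => ?_
    obtain ⟨h1, -, h2⟩ := (hQ b).1 B hb
    obtain ⟨v⟩ := h2.nonempty
    exact Set.disjoint_left.1 (𝔉.disj b c hbc) (h1 v.2) (((hQ c).1 B hc).1 v.2)

lemma SpinedCatForest.subset_verts_of_connected {G : SimpleGraph V} {F : Set V}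
    (𝔉 : SpinedCatForest G F) {B : Set V} (hB : B ⊆ F) (hc : (G.induce B).Connected) :
    ∃ c, B ⊆ (𝔉.comp c).verts := by
  obtain ⟨b⟩ := hc.nonempty
  obtain ⟨c, hbc⟩ := 𝔉.cover b (hB b.2)
  refine ⟨c, fun v hv => ?_⟩
  have key : ∀ u w : B, (G.induce B).Walk u w → u.1 ∈ (𝔉.comp c).verts →
      w.1 ∈ (𝔉.comp c).verts := by
    intro u w p
    induction p with
    | nil => exact id
    | @cons x y z hadj _ ih =>
      intro hx
      obtain ⟨c', hy⟩ := 𝔉.cover y (hB y.2)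
      by_cases hcc : c = c'
      · exact ih (hcc ▸ hy)
      · exact absurd hadj (𝔉.noCross c c' hcc _ hx _ hy)
  obtain ⟨p⟩ := hc.preconnected b ⟨v, hv⟩
  exact key _ _ p hbc

/-- Minimum `d`-coc sets of the caterpillars together with the rest of the graph form a
`d`-coc set. -/
lemma SpinedCatForest.exists_isCocSetOn [Finite V] {G : SimpleGraph V} {M : Set V}
    (𝔉 : SpinedCatForest G Mᶜ) (d : ℕ) :
    ∃ S, M ⊆ S ∧ IsCocSetOn G Set.univ d S ∧
      S.ncard ≤ M.ncard + ∑ c, cocOptOn G (𝔉.comp c).verts d := by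
  choose T hT using fun c => exists_isMinCocSetOn G (𝔉.comp c).verts d
  refine ⟨M ∪ ⋃ c, T c, Set.subset_union_left, isCocSetOn_iff.2 fun B hB hc => ?_, ?_⟩
  · obtain ⟨c, hBc⟩ := 𝔉.subset_verts_of_connected
      (fun v hv hvM => (hB hv).2 (Or.inl hvM)) hc
    exact isCocSetOn_iff.1 (hT c).2.1 B
      (fun v hv => ⟨hBc hv, fun hvT => (hB hv).2 (Or.inr (Set.mem_iUnion.2 ⟨c, hvT⟩))⟩) hc
  · refine (Set.ncard_union_le _ _).trans (Nat.add_le_add_left ?_ _)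
    refine (Set.ncard_iUnion_le_of_fintype _).trans (Finset.sum_le_sum fun c _ => ?_)
    exact (hT c).2.2.le

/-- A vertex outside a `d`-coc set has at most `d - 1` neighbours outside that set. -/
lemma IsCocSetOn.ncard_neighbors_le [Finite V] {G : SimpleGraph V} {S : Set V} {d : ℕ}
    (h : IsCocSetOn G Set.univ d S) {x : V} (hx : x ∉ S) :
    {v | G.Adj v x ∧ v ∉ S}.ncard ≤ d - 1 := by
  have hB : insert x {v | G.Adj v x ∧ v ∉ S} ⊆ Set.univ \ S := by
    rintro v (rfl | hv)
    · exact ⟨trivial, hx⟩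
    · exact ⟨trivial, hv.2⟩
  have hc : (G.induce (insert x {v | G.Adj v x ∧ v ∉ S})).Connected := by
    rw [connected_iff_exists_forall_reachable]
    refine ⟨⟨x, Set.mem_insert _ _⟩, ?_⟩
    rintro ⟨v, rfl | hv⟩
    · exact Reachable.refl _
    · exact Adj.reachable (G := G.induce _) (hv.1.symm : G.Adj x v)
  have hle := isCocSetOn_iff.1 h _ hB hc
  rw [Set.ncard_insert_of_notMem (by simp) (Set.toFinite _)] at hle
  omega

lemma IsCocSetOn.ncard_nbrIn_diff_le [Finite V] {G : SimpleGraph V} {S X A : Set V} {d : ℕ}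
    (h : IsCocSetOn G Set.univ d S) (hSX : Disjoint S X) :
    (nbrIn G A X \ S).ncard ≤ X.ncard * (d - 1) := by
  classical
  have hX := Set.toFinite X
  have hsub : nbrIn G A X \ S ⊆ ⋃ x ∈ hX.toFinset, {v | G.Adj v x ∧ v ∉ S} := by
    rintro v ⟨⟨-, m, hm, hadj⟩, hvS⟩
    simp only [Set.mem_iUnion]
    exact ⟨m, hX.mem_toFinset.2 hm, hadj, hvS⟩
  refine (Set.ncard_le_ncard hsub (Set.toFinite _)).trans ?_
  refine (Finset.set_ncard_biUnion_le _ _).trans ?_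
  rw [Set.ncard_eq_toFinset_card X hX, ← smul_eq_mul]
  refine Finset.sum_le_card_nsmul _ _ _ fun x hx => ?_
  exact h.ncard_neighbors_le (Set.disjoint_right.1 hSX (hX.mem_toFinset.1 hx))

/-- A `d`-coc set containing all neighbours of `X` in `A` pays for the conflict of `X`. -/
lemma HasConflict.cocOptOn_lt [Finite V] {G : SimpleGraph V} {A X S : Set V} {d : ℕ}
    (hconf : HasConflict G d A X) (h : IsCocSetOn G Set.univ d S) (hN : nbrIn G A X ⊆ S) :
    cocOptOn G A d < (S ∩ A).ncard := by
  have hNA : nbrIn G A X ⊆ S ∩ A := fun v hv => ⟨hN hv, hv.1⟩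
  have hle : cocOptOn G (A \ nbrIn G A X) d ≤ ((S ∩ A) \ nbrIn G A X).ncard :=
    cocOptOn_le (fun v hv => ⟨hv.1.2, hv.2⟩)
      (h.mono fun v hv => ⟨trivial, fun hvS => hv.2 ⟨⟨hvS, hv.1.1⟩, hv.1.2⟩⟩)
  have hcard := Set.ncard_sdiff_add_ncard_of_subset hNA (Set.toFinite _)
  unfold HasConflict at hconf
  omega

/-- The number of disjoint connected sets of more than `d` vertices in `A` is at most the
minimum size of a `d`-coc set of `A`. -/
lemma card_le_cocOptOn [Finite V] [Nonempty V] {G : SimpleGraph V} {A : Set V} {d : ℕ}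
    {P : Finset (Set V)}
    (hP : ∀ B ∈ P, B ⊆ A ∧ d + 1 ≤ B.ncard ∧ (G.induce B).Connected)
    (hdisj : (↑P : Set (Set V)).Pairwise fun A B => Disjoint A B) :
    P.card ≤ cocOptOn G A d := by
  obtain ⟨S, -, hS, hcard⟩ := exists_isMinCocSetOn G A d
  obtain ⟨f, hf, hinj⟩ := hS.exists_injOn (P := ↑P) hP hdisj
  rw [← hcard, ← Set.ncard_coe_finset, ← hinj.ncard_image]
  refine Set.ncard_le_ncard ?_ (Set.toFinite _)
  rintro _ ⟨B, hB, rfl⟩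
  exact (hf B hB).1

/-- A `d`-coc set contains, besides one vertex for each set of the packing `P`, a further vertex
for each merged set all of whose neighbours of `X` it contains. -/
lemma IsCocSetOn.card_add_ncard_le [Finite V] [Nonempty V] {G : SimpleGraph V}
    {F S X : Set V} {d : ℕ}
    (h : IsCocSetOn G Set.univ d S) {P : Finset (Set V)}
    (hP : ∀ B ∈ P, B ⊆ F ∧ d + 1 ≤ B.ncard ∧ (G.induce B).Connected)
    (hPdisj : (↑P : Set (Set V)).Pairwise fun A B => Disjoint A B) {R : Set (Set V)}
    (hR : ∀ A ∈ R, (∃ P' ⊆ P, A = ⋃₀ (↑P' : Set (Set V))) ∧ HasConflict G d A X ∧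
      nbrIn G A X ⊆ S)
    (hRdisj : R.Pairwise fun A B => Disjoint A B) :
    P.card + R.ncard ≤ S.ncard := by
  obtain ⟨f, hf, hinj⟩ := h.exists_injOn (P := ↑P)
    (fun B hB => ⟨Set.subset_univ _, (hP B hB).2⟩) hPdisj
  have hex : ∀ A ∈ R, ∃ v, v ∈ S ∩ A ∧ v ∉ f '' P := by
    intro A hA
    obtain ⟨⟨P', hP', rfl⟩, hconf, hN⟩ := hR A hA
    have hlt := hconf.cocOptOn_lt h hN
    have hle : P'.card ≤ cocOptOn G (⋃₀ (↑P' : Set (Set V))) d :=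
      card_le_cocOptOn
        (fun B hB => ⟨Set.subset_sUnion_of_mem (Finset.mem_coe.2 hB), (hP B (hP' hB)).2⟩)
        (hPdisj.mono (Finset.coe_subset.2 hP'))
    have hcard : (f '' (↑P' : Set (Set V))).ncard ≤ P'.card := by
      simpa using Set.ncard_image_le (f := f) P'.finite_toSet
    obtain ⟨v, hv, hvf⟩ := Set.exists_mem_notMem_of_ncard_lt_ncard
      (hcard.trans_lt (hle.trans_lt hlt)) (Set.toFinite _)
    refine ⟨v, hv, ?_⟩
    rintro ⟨B, hB, rfl⟩
    obtain ⟨C, hC, hfC⟩ := hv.2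
    have hBC : B = C := by
      by_contra hne
      exact Set.disjoint_left.1 (hPdisj hB (hP' hC) hne) (hf B hB).2 hfC
    exact hvf ⟨B, hBC ▸ hC, rfl⟩
  choose! g hg hgf using hex
  have hginj : R.InjOn g := injOn_of_forall_mem hRdisj fun A hA => (hg A hA).2
  rw [← Set.ncard_coe_finset, ← hinj.ncard_image, ← hginj.ncard_image,
    ← Set.ncard_union_eq _ (Set.toFinite _) (Set.toFinite _)]
  · refine Set.ncard_le_ncard (Set.union_subset ?_ ?_) (Set.toFinite _)
    · rintro _ ⟨B, hB, rfl⟩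
      exact (hf B hB).1
    · rintro _ ⟨A, hA, rfl⟩
      exact (hg A hA).1
  · refine Set.disjoint_right.2 ?_
    rintro _ ⟨A, hA, rfl⟩
    exact hgf A hA

/-- The number of disjoint sets in which some neighbour of `X` avoids a `d`-coc set that is
disjoint from `X`. -/
lemma IsCocSetOn.ncard_le_of_not_nbrIn_subset [Finite V] [Nonempty V] {G : SimpleGraph V}
    {S X : Set V} {d : ℕ}
    (h : IsCocSetOn G Set.univ d S) (hSX : Disjoint S X) {R : Set (Set V)}
    (hR : ∀ A ∈ R, ¬ nbrIn G A X ⊆ S) (hRdisj : R.Pairwise fun A B => Disjoint A B) :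
    R.ncard ≤ X.ncard * (d - 1) := by
  have hex : ∀ A ∈ R, ∃ v, v ∈ nbrIn G A X \ S := fun A hA => by
    simpa [Set.not_subset] using hR A hA
  choose! g hg using hex
  have hginj : R.InjOn g := injOn_of_forall_mem hRdisj fun A hA => (hg A hA).1.1
  refine le_trans ?_ (h.ncard_nbrIn_diff_le (A := Set.univ) hSX)
  rw [← hginj.ncard_image]
  refine Set.ncard_le_ncard ?_ (Set.toFinite _)
  rintro _ ⟨A, hA, rfl⟩
  exact ⟨⟨trivial, (hg A hA).1.2⟩, (hg A hA).2⟩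

/-- Let `G` be a finite simple graph, `d ≥ 1`, and `M` such that
`G − M` is a caterpillar forest. Let `P̂` be a packing of pairwise vertex-disjoint
connected merged subgraphs of `G − M` and for each chunk `X` let
`P̂^X = {H ∈ P̂ : conf_H(X) > 0}`. Then there is a minimum `d`-coc set `S` of `G`
intersecting every chunk `X` with `|P̂^X| ≥ |M| + 2(d−1)`. -/
theorem stmt17 {V : Type} [Fintype V] (G : SimpleGraph V) (M : Set V)
    (d : ℕ) (hd : 1 ≤ d)
    (𝔉 : SpinedCatForest G Mᶜ) (P : Finset (Set V)) (hP : IsForestSTP G d 𝔉 P)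
    (Phat : Finset (Set V))
    (hmerged : ∀ A ∈ Phat,
      (∃ P' ⊆ P, A = ⋃₀ (↑P' : Set (Set V))) ∧ (G.induce A).Connected)
    (hdisj : (↑Phat : Set (Set V)).Pairwise fun A B => Disjoint A B) :
    ∃ S : Set V, IsMinCocSetOn G Set.univ d S ∧
      ∀ X : Set V, IsChunk M X →
        M.ncard + 2 * (d - 1) ≤ {A : Set V | A ∈ Phat ∧ HasConflict G d A X}.ncard →
        (S ∩ X).Nonempty := by
  obtain ⟨S, hSmin⟩ := exists_isMinCocSetOn G Set.univ d
  by_cases hS : ∀ X : Set V, IsChunk M X →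
      M.ncard + 2 * (d - 1) ≤ {A : Set V | A ∈ Phat ∧ HasConflict G d A X}.ncard →
      (S ∩ X).Nonempty
  · exact ⟨S, hSmin, hS⟩
  push Not at hS
  obtain ⟨X, hX, hle, hSX⟩ := hS
  have : Nonempty V :=
    (Set.nonempty_of_ncard_ne_zero (Nat.one_le_iff_ne_zero.1 hX.2.1)).to_type
  obtain ⟨T, hMT, hT, hTcard⟩ := 𝔉.exists_isCocSetOn d
  obtain ⟨hPmem, hPdisj⟩ := hP.mem_props
  have hsum := hP.sum_cocOptOn_le
  set R := {A : Set V | A ∈ Phat ∧ HasConflict G d A X}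
  have hRdisj : R.Pairwise fun A B => Disjoint A B := hdisj.mono fun A hA => hA.1
  have hgood := hSmin.2.1.card_add_ncard_le (X := X) (R := {A ∈ R | nbrIn G A X ⊆ S}) hPmem hPdisj
    (fun A hA => ⟨(hmerged A hA.1.1).1, hA.1.2, hA.2⟩) (hRdisj.mono fun A hA => hA.1)
  have hbad := hSmin.2.1.ncard_le_of_not_nbrIn_subset (Set.disjoint_iff_inter_eq_empty.2 hSX)
    (R := {A ∈ R | ¬ nbrIn G A X ⊆ S}) (fun A hA => hA.2) (hRdisj.mono fun A hA => hA.1)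
  have hsplit : R.ncard ≤ {A ∈ R | nbrIn G A X ⊆ S}.ncard + {A ∈ R | ¬ nbrIn G A X ⊆ S}.ncard := by
    refine le_trans (Set.ncard_le_ncard (fun A hA => ?_) (Set.toFinite _)) (Set.ncard_union_le _ _)
    by_cases hN : nbrIn G A X ⊆ S
    · exact Or.inl ⟨hA, hN⟩
    · exact Or.inr ⟨hA, hN⟩
  have hXcard : X.ncard * (d - 1) ≤ 2 * (d - 1) := Nat.mul_le_mul_right _ hX.2.2
  have hopt := cocOptOn_le (Set.subset_univ T) hT
  have hScard := hSmin.2.2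
  refine ⟨T, ⟨Set.subset_univ _, hT, by omega⟩, fun Y hY _ => ?_⟩
  obtain ⟨y, hy⟩ := Set.nonempty_of_ncard_ne_zero (Nat.one_le_iff_ne_zero.1 hY.2.1)
  exact ⟨y, hMT (hY.1 hy), hy⟩

end CocPaper
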